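/- arXiv:2007.05705 — 2 statements merged into one kernel-verified Lean document; each statement's English description precedes it below -/
import Mathlib

section
/- Let the gain matrix Γ = (γ_ij)_{i,j∈ℕ}, with γ_ij of class K∞ ∪ {0}, be block-diagonal: ℕ is partitioned into consecutive finite blocks B₁, B₂, … of sizes n₁, n₂, … < ∞ and γ_ij = 0 whenever i and j lie in different blocks; write Γ_⊗ = diag(Γ_{1,⊗}, Γ_{2,⊗}, …) for the induced gain operators, where Γ_{m,⊗} : ℝ^{n_m}₊ → ℝ^{n_m}₊ is the max-form gain operator built from the gains of block m. Assume Γ_⊗ is well-defined on ℓ∞(ℕ)⁺. Then the following are equivalent: (i) Γ_⊗ : ℓ∞(ℕ)⁺ → ℓ∞(ℕ)⁺ satisfies the small-gain condition; (ii) for every m ∈ ℕ, the operator Γ_{m,⊗} satisfies the small-gain condition; (iii) all cycles built from the gains of Γ are contractions (γ_{i₁i₂}∘⋯∘γ_{i_{k−1}i_k}(r) < r for all r > 0 whenever i₁ = i_k); (iv) for every m ∈ ℕ, all cycles built from the gains of block m are contractions. -/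
open Filter Set

noncomputable section

/-- A function of class `K`: continuous on `[0,∞)`, strictly increasing on `[0,∞)`,
and vanishing at `0`. -/
def IsClassK (γ : ℝ → ℝ) : Prop :=
  ContinuousOn γ (Set.Ici 0) ∧ StrictMonoOn γ (Set.Ici 0) ∧ γ 0 = 0

/-- A function of class `K∞`: class `K` and unbounded. -/
def IsClassKInf (γ : ℝ → ℝ) : Prop :=
  IsClassK γ ∧ Filter.Tendsto γ Filter.atTop Filter.atTop

/-- A function of class `K ∪ {0}`: either of class `K` or identically zero on `[0,∞)`. -/
def IsClassK0 (γ : ℝ → ℝ) : Prop :=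
  IsClassK γ ∨ Set.EqOn γ 0 (Set.Ici 0)
/-- Membership in the positive cone `ℓ∞(I)⁺` of the space of bounded real-valued
functions on `I`: componentwise nonnegative and bounded. -/
def InLinfPos {I : Type*} (x : I → ℝ) : Prop :=
  (∀ i, 0 ≤ x i) ∧ BddAbove (Set.range fun i => |x i|)

/-- The supremum norm on bounded real-valued functions on `I`. -/
def supNorm {I : Type*} (x : I → ℝ) : ℝ := ⨆ i, |x i|

/-- The max-form gain operator `Γ_⊗(x)_i = sup_j γ_ij(x_j)`. -/
def gainOpMax {I : Type*} (γ : I → I → ℝ → ℝ) (x : I → ℝ) : I → ℝ :=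
  fun i => ⨆ j, γ i j (x j)
/-- The composition of gains along a chain of indices:
`chainVal γ n i j r = γ_{i,j₀}(γ_{j₀,j₁}(⋯ γ_{j_{n-2},j_{n-1}}(r) ⋯))`. -/
def chainVal {I : Type*} (γ : I → I → ℝ → ℝ) : (n : ℕ) → I → (Fin n → I) → ℝ → ℝ
  | 0, _, _, r => r
  | n + 1, i, j, r => γ i (j 0) (chainVal γ n (j 0) (fun k => j k.succ) r)

/-- A function of class `K∞ ∪ {0}`. -/
def IsClassKInf0 (γ : ℝ → ℝ) : Prop :=
  IsClassKInf γ ∨ Set.EqOn γ 0 (Set.Ici 0)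

lemma KInf0_zero {g : ℝ → ℝ} (h : IsClassKInf0 g) : g 0 = 0 := by
  rcases h with h | h
  · exact h.1.2.2
  · exact h (by simp : (0 : ℝ) ∈ Set.Ici 0)

lemma KInf0_mono {g : ℝ → ℝ} (h : IsClassKInf0 g) {a b : ℝ} (ha : 0 ≤ a) (hab : a ≤ b) :
    g a ≤ g b := by
  rcases h with h | h
  · exact h.1.2.1.monotoneOn (Set.mem_Ici.2 ha) (Set.mem_Ici.2 (ha.trans hab)) hab
  · rw [h (Set.mem_Ici.2 ha), h (Set.mem_Ici.2 (ha.trans hab))]; simp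

lemma KInf0_nonneg {g : ℝ → ℝ} (h : IsClassKInf0 g) {a : ℝ} (ha : 0 ≤ a) : 0 ≤ g a := by
  have := KInf0_mono h le_rfl ha
  rwa [KInf0_zero h] at this

lemma chain_values {I : Type*} (γ : I → I → ℝ → ℝ) (hγ : ∀ i j, IsClassKInf0 (γ i j))
    (r : ℝ) (hr : 0 ≤ r) : ∀ (k : ℕ) (p : Fin (k + 1) → I), ∃ v : Fin (k + 1) → ℝ,
      v 0 = chainVal γ k (p 0) (fun t => p t.succ) r ∧ v (Fin.last k) = r ∧ (∀ t, 0 ≤ v t) ∧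
      ∀ t : Fin k, v t.castSucc = γ (p t.castSucc) (p t.succ) (v t.succ) := by
  intro k
  induction k with
  | zero =>
    intro p
    exact ⟨fun _ => r, rfl, rfl, fun _ => hr, fun t => t.elim0⟩
  | succ k ih =>
    intro p
    obtain ⟨v, h0, hl, hp, hs⟩ := ih (fun t => p t.succ)
    refine ⟨Fin.cons (γ (p 0) (p 1) (v 0)) v, ?_, ?_, ?_, ?_⟩
    · simp only [Fin.cons_zero, chainVal, h0]
      rfl
    · rw [← Fin.succ_last, Fin.cons_succ, hl]
    · intro t
      refine Fin.cases ?_ (fun t => ?_) t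
      · exact KInf0_nonneg (hγ _ _) (hp 0)
      · exact hp t
    · intro t
      refine Fin.cases ?_ (fun t => ?_) t
      · rfl
      · rw [Fin.castSucc_succ, Fin.cons_succ, Fin.cons_succ, hs t]

lemma cycle_of_smallgain {I : Type*} (γ : I → I → ℝ → ℝ) (hγ : ∀ i j, IsClassKInf0 (γ i j))
    (hb : ∀ x : I → ℝ, InLinfPos x → ∀ i, BddAbove (Set.range fun j => γ i j (x j)))
    (H : ∀ x : I → ℝ, InLinfPos x → x ≠ 0 → ¬ ∀ i, x i ≤ gainOpMax γ x i)
    (k : ℕ) (hk : 1 ≤ k) (p : Fin (k + 1) → I) (hp : p 0 = p (Fin.last k)) (r : ℝ) (hr : 0 < r) :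
    chainVal γ k (p 0) (fun t => p t.succ) r < r := by
  classical
  by_contra hc
  push Not at hc
  obtain ⟨v, h0, hl, hv, hs⟩ := chain_values γ hγ r hr.le k p
  rw [← h0] at hc
  set x : I → ℝ := fun i => ⨆ t : Fin (k + 1), (if p t = i then v t else 0) with hx
  have hfin : ∀ i, BddAbove (Set.range fun t : Fin (k + 1) => if p t = i then v t else 0) :=
    fun i => (Set.finite_range _).bddAbove
  have hvx : ∀ t, v t ≤ x (p t) := by
    intro t
    have := le_ciSup (hfin (p t)) t
    simpa using this
  have hx0 : ∀ i, 0 ≤ x i := by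
    intro i
    refine Real.iSup_nonneg fun t => ?_
    split_ifs
    · exact hv t
    · exact le_rfl
  have hbd : BddAbove (Set.range fun i => |x i|) := by
    refine ⟨⨆ t, v t, ?_⟩
    rintro _ ⟨i, rfl⟩
    have hvb : BddAbove (Set.range v) := (Set.finite_range _).bddAbove
    simp only [abs_of_nonneg (hx0 i)]
    refine ciSup_le fun t => ?_
    split_ifs
    · exact le_ciSup hvb t
    · exact (hv t).trans (le_ciSup hvb t)
  have hxI : InLinfPos x := ⟨hx0, hbd⟩
  have hstep : ∀ t : Fin k, v t.castSucc ≤ gainOpMax γ x (p t.castSucc) := by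
    intro t
    rw [hs t]
    exact (KInf0_mono (hγ _ _) (hv _) (hvx t.succ)).trans
      (le_ciSup (hb x hxI (p t.castSucc)) (p t.succ))
  refine H x hxI ?_ ?_
  · intro h
    have := hvx (Fin.last k)
    rw [hl, h] at this
    simp at this
    linarith
  · intro i
    refine ciSup_le fun t => ?_
    split_ifs with hpi
    · subst hpi
      refine Fin.lastCases ?_ (fun t => hstep t) t
      rw [hl, ← hp]
      have := hstep ⟨0, hk⟩
      exact hc.trans this
    · exact Real.iSup_nonneg fun j => KInf0_nonneg (hγ _ _) (hx0 j)

lemma smallgain_of_cycle {I : Type*} [Finite I] (γ : I → I → ℝ → ℝ)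
    (hγ : ∀ i j, IsClassKInf0 (γ i j))
    (H : ∀ k : ℕ, 1 ≤ k → ∀ p : Fin (k + 1) → I, p 0 = p (Fin.last k) → ∀ r : ℝ, 0 < r →
      chainVal γ k (p 0) (fun t => p t.succ) r < r)
    (x : I → ℝ) (hx : ∀ a, 0 ≤ x a) (hne : x ≠ 0) : ¬ ∀ a, x a ≤ gainOpMax γ x a := by
  intro hle
  obtain ⟨a0, ha0⟩ := Function.ne_iff.1 hne
  have ha0' : 0 < x a0 := lt_of_le_of_ne (hx a0) (Ne.symm ha0)
  have hex : ∀ a : {a // 0 < x a}, ∃ b : {a // 0 < x a}, x a ≤ γ a b (x b) := by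
    rintro ⟨a, ha⟩
    haveI : Nonempty I := ⟨a⟩
    obtain ⟨b, hb⟩ := exists_eq_ciSup_of_finite (f := fun j => γ a j (x j))
    have h1 : x a ≤ γ a b (x b) := by
      have := hle a
      unfold gainOpMax at this
      rwa [← hb] at this
    refine ⟨⟨b, ?_⟩, h1⟩
    refine lt_of_le_of_ne (hx b) fun h => ?_
    rw [← h, KInf0_zero (hγ _ _)] at h1
    linarith
  choose g hg using hex
  let f : ℕ → {a // 0 < x a} := fun t => g^[t] ⟨a0, ha0'⟩
  have hf : ∀ t, x (f t) ≤ γ (f t) (f (t + 1)) (x (f (t + 1))) := by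
    intro t
    have : f (t + 1) = g (f t) := Function.iterate_succ_apply' _ _ _
    rw [this]
    exact hg _
  have hch : ∀ k s, x (f s) ≤ chainVal γ k (f s) (fun t : Fin k => (f (s + t + 1) : I))
      (x (f (s + k))) := by
    intro k
    induction k with
    | zero => intro s; exact le_rfl
    | succ k ih =>
      intro s
      refine (hf s).trans ?_
      have h := KInf0_mono (hγ (f s) (f (s + 1))) (hx _) (ih (s + 1))
      refine h.trans (le_of_eq ?_)
      simp only [chainVal, Fin.val_zero, add_zero, Fin.val_succ]
      have e2 : (fun t : Fin k => (f (s + 1 + t + 1) : I)) =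
          fun t : Fin k => (f (s + (t + 1) + 1) : I) := by
        funext t
        rw [show s + 1 + (t : ℕ) + 1 = s + (t + 1) + 1 by ring]
      rw [e2, show s + (k + 1) = s + 1 + k by ring]
  obtain ⟨s, t, hst, he⟩ : ∃ s t, s < t ∧ f s = f t := by
    obtain ⟨s, t, hne, he⟩ := Finite.exists_ne_map_eq_of_infinite f
    rcases lt_or_gt_of_ne hne with h | h
    · exact ⟨s, t, h, he⟩
    · exact ⟨t, s, h, he.symm⟩
  obtain ⟨k, rfl⟩ := Nat.exists_eq_add_of_lt hst
  have h1 := hch (k + 1) s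
  have h2 := H (k + 1) (by omega) (fun t => (f (s + t) : I))
    (by simpa [add_assoc] using congrArg Subtype.val he) (x (f s)) (f s).2
  have e : f (s + (k + 1)) = f s := he.symm
  rw [e] at h1
  exact absurd h2 (not_lt.2 h1)

lemma chainVal_map {I J : Type*} (γ : I → I → ℝ → ℝ) (φ : J → I) (r : ℝ) :
    ∀ (k : ℕ) (i : J) (j : Fin k → J),
      chainVal (fun a b => γ (φ a) (φ b)) k i j r = chainVal γ k (φ i) (fun t => φ (j t)) r := by
  intro k
  induction k with
  | zero => intro i j; rfl
  | succ k ih => intro i j; simp only [chainVal, ih]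

/-- For a block-diagonal gain matrix (index set partitioned into finite
blocks, modeled by the sigma type `Σ m, Fin (n m)`, with gains vanishing across distinct
blocks, gains of class `K∞ ∪ {0}`, and `Γ_⊗` well-defined on `ℓ∞⁺`), TFAE:
(i) `Γ_⊗` satisfies the small-gain condition on `ℓ∞⁺`;
(ii) each block operator `Γ_{m,⊗}` satisfies the small-gain condition;
(iii) all cycles built from the gains of `Γ` are contractions;
(iv) all cycles built from the gains of each block are contractions. -/
theorem block_diagonal_small_gain_tfae
    (n : ℕ → ℕ) (hn : ∀ m, 0 < n m)
    (γ : ((m : ℕ) × Fin (n m)) → ((m : ℕ) × Fin (n m)) → ℝ → ℝ)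
    (hγ : ∀ i j, IsClassKInf0 (γ i j))
    (hblock : ∀ i j : (m : ℕ) × Fin (n m), i.1 ≠ j.1 → ∀ r : ℝ, 0 ≤ r → γ i j r = 0)
    (hwd : ∀ r : ℝ, 0 < r → BddAbove
      (Set.range fun p : ((m : ℕ) × Fin (n m)) × ((m : ℕ) × Fin (n m)) =>
        γ p.1 p.2 r)) :
    List.TFAE
      [ -- (i) small-gain condition for `Γ_⊗` on `ℓ∞⁺`
        ∀ x : ((m : ℕ) × Fin (n m)) → ℝ, InLinfPos x → x ≠ 0 →
          ¬ ∀ i, x i ≤ gainOpMax γ x i,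
        -- (ii) small-gain condition for each block operator `Γ_{m,⊗}`
        ∀ m : ℕ, ∀ x : Fin (n m) → ℝ, (∀ a, 0 ≤ x a) → x ≠ 0 →
          ¬ ∀ a, x a ≤ gainOpMax (fun a b : Fin (n m) => γ ⟨m, a⟩ ⟨m, b⟩) x a,
        -- (iii) all cycles of `Γ` are contractions
        ∀ k : ℕ, 1 ≤ k → ∀ p : Fin (k + 1) → (m : ℕ) × Fin (n m),
          p 0 = p (Fin.last k) → ∀ r : ℝ, 0 < r →
            chainVal γ k (p 0) (fun t => p t.succ) r < r,
        -- (iv) all cycles of each block are contractions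
        ∀ m : ℕ, ∀ k : ℕ, 1 ≤ k → ∀ p : Fin (k + 1) → Fin (n m),
          p 0 = p (Fin.last k) → ∀ r : ℝ, 0 < r →
            chainVal (fun a b : Fin (n m) => γ ⟨m, a⟩ ⟨m, b⟩) k (p 0)
              (fun t => p t.succ) r < r ] := by
  tfae_have 1 → 3 := by
    intro H
    refine cycle_of_smallgain γ hγ ?_ H
    rintro x ⟨hx, M, hM⟩ i
    obtain ⟨C, hC⟩ := hwd (max M 1) (by positivity)
    refine ⟨C, ?_⟩
    rintro _ ⟨j, rfl⟩
    have h1 : x j ≤ max M 1 :=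
      (le_abs_self _).trans ((hM ⟨j, rfl⟩).trans (le_max_left _ _))
    exact (KInf0_mono (hγ i j) (hx j) h1).trans (hC ⟨(i, j), rfl⟩)
  tfae_have 3 → 4 := by
    intro H m k hk p hp r hr
    have := H k hk (fun t => ⟨m, p t⟩) (by simp only [hp]) r hr
    exact (chainVal_map γ (fun a : Fin (n m) => (⟨m, a⟩ : (m : ℕ) × Fin (n m))) r k _ _).trans_lt
      this
  tfae_have 4 → 2 := by
    intro H m
    exact smallgain_of_cycle _ (fun a b => hγ _ _) (H m)
  tfae_have 2 → 1 := by
    intro H x hx hne hle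
    obtain ⟨⟨m, a0⟩, ha0⟩ := Function.ne_iff.1 hne
    refine H m (fun a => x ⟨m, a⟩) (fun a => hx.1 _) (fun h => ha0 (congrFun h a0)) ?_
    intro a
    haveI : Nonempty ((m : ℕ) × Fin (n m)) := ⟨⟨m, a⟩⟩
    refine (hle ⟨m, a⟩).trans (ciSup_le ?_)
    rintro ⟨m', b⟩
    by_cases hm : m = m'
    · subst hm
      exact le_ciSup (f := fun b => γ ⟨m, a⟩ ⟨m, b⟩ (x ⟨m, b⟩)) (Set.finite_range _).bddAbove b
    · rw [hblock _ _ hm _ (hx.1 _)]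
      exact Real.iSup_nonneg fun j => KInf0_nonneg (hγ _ _) (hx.1 _)
  tfae_finish
end
end

section
/- Let γ_ij, (i,j) ∈ ℕ×ℕ, be gains of class K ∪ {0} such that the gain operator Γ_⊗ : ℓ∞(ℕ)⁺ → ℓ∞(ℕ)⁺ is well-defined and continuous, and assume Γ_⊗ satisfies the robust small-gain condition with a function ω of class K∞, ω(r) < r for r > 0. Then the operator Q defined by Q(s) := sup_{k ∈ ℕ∪{0}} Γ_⊗ᵏ(s) (componentwise supremum) is well-defined from ℓ∞(ℕ)⁺ to ℓ∞(ℕ)⁺ and satisfies: (i) s ≤ Q(s) ≤ ω⁻¹(‖s‖_{ℓ∞})·𝟏 for all s ∈ ℓ∞(ℕ)⁺, and in particular ‖s‖_{ℓ∞} ≤ ‖Q(s)‖_{ℓ∞} ≤ ω⁻¹(‖s‖_{ℓ∞}); (ii) Γ_⊗(Q(s)) = Q(Γ_⊗(s)) ≤ Q(s) for all s ∈ ℓ∞(ℕ)⁺. -/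
open Filter Set

noncomputable section

section helpers

theorem K0_nonneg_mono {g : ℝ → ℝ} (h : IsClassK0 g) :
    (∀ a b, 0 ≤ a → a ≤ b → g a ≤ g b) ∧ (∀ a, 0 ≤ a → 0 ≤ g a) ∧ g 0 = 0 := by
  rcases h with ⟨_, hm, h0⟩ | h
  · refine ⟨fun a b ha hab => hm.monotoneOn ha (le_trans ha hab) hab, fun a ha => ?_, h0⟩
    have := hm.monotoneOn (show (0:ℝ) ∈ Ici 0 by simp) ha ha
    rwa [h0] at this
  · have h' : ∀ a, 0 ≤ a → g a = 0 := fun a ha => h ha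
    refine ⟨fun a b ha hab => ?_, fun a ha => (h' a ha).ge, h' 0 le_rfl⟩
    rw [h' a ha, h' b (ha.trans hab)]

theorem K0_left {g : ℝ → ℝ} (h : IsClassK0 g) {a c : ℝ} (ha : 0 ≤ a) (hc : 0 ≤ c)
    (hca : c < g a) : ∃ c', 0 ≤ c' ∧ c' < a ∧ ∀ v, c' < v → c < g v := by
  rcases h with ⟨hcn, hm, h0⟩ | h
  · have hiv := intermediate_value_Icc ha (hcn.mono Icc_subset_Ici_self)
    rw [h0] at hiv
    obtain ⟨c', ⟨h1, h2⟩, h3⟩ := hiv ⟨hc, hca.le⟩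
    refine ⟨c', h1, lt_of_le_of_ne h2 ?_, fun v hv => ?_⟩
    · rintro rfl
      exact absurd h3 hca.ne'
    · rw [← h3]
      exact hm h1 (h1.trans hv.le) hv
  · have : g a = 0 := h ha
    linarith

variable {γ : ℕ → ℕ → ℝ → ℝ}

theorem bound_of {x : ℕ → ℝ} (hx : InLinfPos x) : ∃ R, 0 < R ∧ ∀ i, x i ≤ R := by
  obtain ⟨R, hR⟩ := hx.2
  refine ⟨max R 1, by positivity, fun i => ?_⟩
  exact (le_abs_self _).trans ((hR ⟨i, rfl⟩).trans (le_max_left _ _))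

theorem inL_of {x : ℕ → ℝ} (h : ∀ i, 0 ≤ x i) {R : ℝ} (hR : ∀ i, x i ≤ R) : InLinfPos x := by
  refine ⟨h, R, ?_⟩
  rintro _ ⟨i, rfl⟩
  simpa only [abs_of_nonneg (h i)] using hR i

theorem le_supNorm {x : ℕ → ℝ} (hx : InLinfPos x) (i : ℕ) : x i ≤ supNorm x :=
  (le_abs_self _).trans (le_ciSup hx.2 i)

theorem supNorm_le {x : ℕ → ℝ} (h : ∀ i, 0 ≤ x i) {R : ℝ} (hR : ∀ i, x i ≤ R) :
    supNorm x ≤ R := by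
  refine ciSup_le fun i => ?_
  rw [abs_of_nonneg (h i)]
  exact hR i

theorem gain_bdd (hγ : ∀ i j, IsClassK0 (γ i j))
    (hwd : ∀ r : ℝ, 0 < r → BddAbove (Set.range fun p : ℕ × ℕ => γ p.1 p.2 r))
    {x : ℕ → ℝ} (hx : InLinfPos x) : ∃ B, ∀ i j, γ i j (x j) ≤ B := by
  obtain ⟨R, hR, hxR⟩ := bound_of hx
  obtain ⟨B, hB⟩ := hwd R hR
  exact ⟨B, fun i j => ((K0_nonneg_mono (hγ i j)).1 _ _ (hx.1 j) (hxR j)).trans (hB ⟨(i, j), rfl⟩)⟩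

theorem le_gain (hγ : ∀ i j, IsClassK0 (γ i j))
    (hwd : ∀ r : ℝ, 0 < r → BddAbove (Set.range fun p : ℕ × ℕ => γ p.1 p.2 r))
    {x : ℕ → ℝ} (hx : InLinfPos x) (i j : ℕ) : γ i j (x j) ≤ gainOpMax γ x i := by
  obtain ⟨B, hB⟩ := gain_bdd hγ hwd hx
  refine le_ciSup (f := fun j => γ i j (x j)) ⟨B, ?_⟩ j
  rintro _ ⟨j, rfl⟩
  exact hB i j

theorem gain_inL (hγ : ∀ i j, IsClassK0 (γ i j))
    (hwd : ∀ r : ℝ, 0 < r → BddAbove (Set.range fun p : ℕ × ℕ => γ p.1 p.2 r))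
    {x : ℕ → ℝ} (hx : InLinfPos x) : InLinfPos (gainOpMax γ x) := by
  obtain ⟨B, hB⟩ := gain_bdd hγ hwd hx
  refine inL_of (fun i => ?_) (fun i => ciSup_le (hB i))
  exact ((K0_nonneg_mono (hγ i 0)).2.1 _ (hx.1 0)).trans (le_gain hγ hwd hx i 0)

theorem gain_mono (hγ : ∀ i j, IsClassK0 (γ i j))
    (hwd : ∀ r : ℝ, 0 < r → BddAbove (Set.range fun p : ℕ × ℕ => γ p.1 p.2 r))
    {x y : ℕ → ℝ} (hx : InLinfPos x) (hy : InLinfPos y) (h : ∀ i, x i ≤ y i) (i : ℕ) :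
    gainOpMax γ x i ≤ gainOpMax γ y i :=
  ciSup_le fun j => ((K0_nonneg_mono (hγ i j)).1 _ _ (hx.1 j) (h j)).trans (le_gain hγ hwd hy i j)

theorem iter_inL (hγ : ∀ i j, IsClassK0 (γ i j))
    (hwd : ∀ r : ℝ, 0 < r → BddAbove (Set.range fun p : ℕ × ℕ => γ p.1 p.2 r))
    {s : ℕ → ℝ} (hs : InLinfPos s) (k : ℕ) : InLinfPos ((gainOpMax γ)^[k] s) := by
  induction k with
  | zero => exact hs
  | succ k ih =>
    rw [Function.iterate_succ_apply']
    exact gain_inL hγ hwd ih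

theorem path_exists (hγ : ∀ i j, IsClassK0 (γ i j))
    (hwd : ∀ r : ℝ, 0 < r → BddAbove (Set.range fun p : ℕ × ℕ => γ p.1 p.2 r))
    {s : ℕ → ℝ} (hs : InLinfPos s) (k : ℕ) :
    ∀ i c, 0 ≤ c → c < (gainOpMax γ)^[k] s i →
      ∃ x : ℕ → ℝ, ∃ j0, InLinfPos x ∧ c < x i ∧
        ∀ l, x l ≤ gainOpMax γ x l ∨ (l = j0 ∧ x l ≤ s l) := by
  induction k with
  | zero =>
    intro i c hc hci
    have hci' : c < s i := hci
    have hx : InLinfPos (Pi.single i (s i) : ℕ → ℝ) := by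
      refine inL_of (R := s i) (fun l => ?_) (fun l => ?_)
      · by_cases h : l = i
        · subst h; simpa using hs.1 l
        · simp [h]
      · by_cases h : l = i
        · subst h; simp
        · simpa [h] using hs.1 i
    refine ⟨Pi.single i (s i), i, hx, by simpa using hci', fun l => ?_⟩
    by_cases h : l = i
    · right; subst h; simp
    · left
      have := (gain_inL hγ hwd hx).1 l
      simpa [h] using this
  | succ k ih =>
    intro i c hc hci
    rw [Function.iterate_succ_apply'] at hci
    obtain ⟨j, hj⟩ := exists_lt_of_lt_ciSup hci
    have hk := iter_inL hγ hwd hs k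
    obtain ⟨c', h0, h1, h2⟩ := K0_left (hγ i j) (hk.1 j) hc hj
    obtain ⟨x, j0, hx, hxj, hxl⟩ := ih j c' h0 h1
    obtain ⟨R, hR, hxR⟩ := bound_of hx
    have hge : ∀ l, x l ≤ Function.update x i (max (x i) (γ i j (x j))) l := by
      intro l
      by_cases h : l = i
      · subst h; simp
      · simp [h]
    have hx' : InLinfPos (Function.update x i (max (x i) (γ i j (x j)))) := by
      refine inL_of (R := max R (γ i j (x j))) (fun l => (hx.1 l).trans (hge l)) (fun l => ?_)
      by_cases h : l = i
      · subst h
        simp only [Function.update_self]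
        exact max_le_max (hxR l) le_rfl
      · simp only [Function.update_of_ne h]
        exact (hxR l).trans (le_max_left _ _)
    have hm := gain_mono hγ hwd hx hx' hge
    refine ⟨_, j0, hx', ?_, fun l => ?_⟩
    · simp only [Function.update_self]
      exact (h2 _ hxj).trans_le (le_max_right _ _)
    · by_cases h : l = i
      · subst h
        rw [Function.update_self]
        rcases le_total (x l) (γ l j (x j)) with h3 | h3
        · left
          rw [max_eq_right h3]
          rw [max_eq_right h3] at hm
          exact (le_gain hγ hwd hx l j).trans (hm l)
        · rw [max_eq_left h3]
          rw [max_eq_left h3] at hm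
          exact (hxl l).imp_left fun h4 => h4.trans (hm l)
      · rw [Function.update_of_ne h]
        exact (hxl l).imp_left fun h4 => h4.trans (hm l)

end helpers

/-- Suppose the gain operator `Γ_⊗` on `ℓ∞(ℕ)⁺` (built from gains of class
`K ∪ {0}`) is well-defined and continuous, and satisfies the robust small-gain condition
with `ω ∈ K∞`, `ω < id`. Then `Q(s) = sup_{k≥0} Γ_⊗ᵏ(s)` (componentwise) is well-defined
from `ℓ∞(ℕ)⁺` to `ℓ∞(ℕ)⁺` and satisfies
(i) `s ≤ Q(s) ≤ ω⁻¹(‖s‖)·𝟏`, in particular `‖s‖ ≤ ‖Q(s)‖ ≤ ω⁻¹(‖s‖)`;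
(ii) `Γ_⊗(Q(s)) = Q(Γ_⊗(s)) ≤ Q(s)`. -/
theorem strong_transitive_closure_properties
    (γ : ℕ → ℕ → ℝ → ℝ)
    (hγ : ∀ i j, IsClassK0 (γ i j))
    (hwd : ∀ r : ℝ, 0 < r → BddAbove (Set.range fun p : ℕ × ℕ => γ p.1 p.2 r))
    (hcont : ∀ x : ℕ → ℝ, InLinfPos x → ∀ ε : ℝ, 0 < ε → ∃ δ : ℝ, 0 < δ ∧
      ∀ y : ℕ → ℝ, InLinfPos y → supNorm (fun i => x i - y i) ≤ δ →
        supNorm (fun i => gainOpMax γ x i - gainOpMax γ y i) ≤ ε)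
    (ω : ℝ → ℝ) (hω : IsClassKInf ω) (hωlt : ∀ r : ℝ, 0 < r → ω r < r)
    (hrsgc : ∀ i j : ℕ, ∀ x : ℕ → ℝ, InLinfPos x → x ≠ 0 →
      ¬ ∀ l, x l ≤ gainOpMax γ x l + (if l = i then ω (x j) else 0)) :
    ∀ Q : (ℕ → ℝ) → ℕ → ℝ,
      (∀ s i, Q s i = ⨆ k : ℕ, (gainOpMax γ)^[k] s i) →
      ∀ s : ℕ → ℝ, InLinfPos s →
        (∀ i, BddAbove (Set.range fun k : ℕ => (gainOpMax γ)^[k] s i)) ∧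
        InLinfPos (Q s) ∧
        (∀ i, s i ≤ Q s i) ∧
        (∀ ωinv : ℝ → ℝ, (∀ r : ℝ, 0 ≤ r → ωinv (ω r) = r) →
          (∀ i, Q s i ≤ ωinv (supNorm s)) ∧ supNorm (Q s) ≤ ωinv (supNorm s)) ∧
        supNorm s ≤ supNorm (Q s) ∧
        (∀ i, gainOpMax γ (Q s) i = Q (gainOpMax γ s) i) ∧
        (∀ i, gainOpMax γ (Q s) i ≤ Q s i) := by
  intro Q hQ s hs
  have hit := fun k => iter_inL hγ hwd hs k
  have hS0 : 0 ≤ supNorm s := (hs.1 0).trans (le_supNorm hs 0)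
  obtain ⟨⟨hωc, hωm, hω0⟩, hωt⟩ := hω
  obtain ⟨M, hM0, hM⟩ : ∃ M, 0 ≤ M ∧ ω M = supNorm s := by
    obtain ⟨b, hb, hb0⟩ := ((hωt.eventually_ge_atTop (supNorm s)).and (eventually_ge_atTop 0)).exists
    have := intermediate_value_Icc hb0 (hωc.mono Icc_subset_Ici_self)
    rw [hω0] at this
    obtain ⟨M, h1, h2⟩ := this ⟨hS0, hb⟩
    exact ⟨M, h1.1, h2⟩
  have hbd : ∀ k i, (gainOpMax γ)^[k] s i ≤ M := by
    intro k i
    by_contra! hlt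
    obtain ⟨x, j0, hx, hxi, hxl⟩ := path_exists hγ hwd hs k i M hM0 hlt
    refine hrsgc j0 i x hx ?_ fun l => ?_
    · rintro rfl
      exact absurd hxi (not_lt.2 hM0)
    · have hw : supNorm s < ω (x i) := hM ▸ hωm hM0 (hx.1 i) hxi
      have hg := (gain_inL hγ hwd hx).1 l
      rcases hxl l with h | ⟨h, h'⟩
      · split_ifs <;> linarith
      · rw [if_pos h]
        linarith [le_supNorm hs l]
  have hB : ∀ i, BddAbove (Set.range fun k : ℕ => (gainOpMax γ)^[k] s i) := by
    intro i
    refine ⟨M, ?_⟩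
    rintro _ ⟨k, rfl⟩
    exact hbd k i
  have hle : ∀ k i, (gainOpMax γ)^[k] s i ≤ Q s i := by
    intro k i
    rw [hQ]
    exact le_ciSup (hB i) k
  have hQM : ∀ i, Q s i ≤ M := by
    intro i
    rw [hQ]
    exact ciSup_le fun k => hbd k i
  have hsQ : ∀ i, s i ≤ Q s i := hle 0
  have hQ0 : ∀ i, 0 ≤ Q s i := fun i => (hs.1 i).trans (hsQ i)
  have hQL : InLinfPos (Q s) := inL_of hQ0 hQM
  have hB1 : ∀ i, BddAbove (Set.range fun k : ℕ => (gainOpMax γ)^[k] (gainOpMax γ s) i) := by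
    intro i
    refine ⟨M, ?_⟩
    rintro _ ⟨k, rfl⟩
    exact hbd (k + 1) i
  have hle1 : ∀ k i, (gainOpMax γ)^[k + 1] s i ≤ Q (gainOpMax γ s) i := by
    intro k i
    rw [hQ]
    exact le_ciSup (hB1 i) k
  have heq : ∀ i, gainOpMax γ (Q s) i = Q (gainOpMax γ s) i := by
    intro i
    apply le_antisymm
    · refine ciSup_le fun j => ?_
      by_contra! hlt
      have h0 : 0 ≤ Q (gainOpMax γ s) i := ((hit 1).1 i).trans (hle1 0 i)
      obtain ⟨c', _, h2, h3⟩ := K0_left (hγ i j) (hQ0 j) h0 hlt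
      rw [hQ s j] at h2
      obtain ⟨k, hk⟩ := exists_lt_of_lt_ciSup h2
      have h4 := h3 _ hk
      have h5 := le_gain hγ hwd (hit k) i j
      rw [← Function.iterate_succ_apply' (gainOpMax γ) k s] at h5
      linarith [hle1 k i]
    · rw [hQ]
      refine ciSup_le fun k => ?_
      rw [← Function.iterate_succ_apply, Function.iterate_succ_apply']
      exact gain_mono hγ hwd (hit k) hQL (hle k) i
  refine ⟨hB, hQL, hsQ, ?_, ?_, heq, fun i => ?_⟩
  · intro ωinv hinv
    rw [← hM, hinv M hM0]
    exact ⟨hQM, supNorm_le hQ0 hQM⟩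
  · exact supNorm_le hs.1 fun i => (hsQ i).trans (le_supNorm hQL i)
  · rw [heq, hQ]
    exact ciSup_le fun k => hle (k + 1) i
end
end
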